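/- Let q ≥ 3 and n ≥ 3. Then the sets A_q(n), B_q(n) and C_q(n) are pairwise disjoint, and consequently |CBFS_q(n)| = |A_q(n)| + |B_q(n)| + |C_q(n)|. -/

import Mathlib

/-- Value of a letter: 1 ↦ +1, 0 ↦ -1, other letters ↦ 0. -/
def mval (a : ℕ) : ℤ := if a = 1 then 1 else if a = 0 then -1 else 0

/-- Value-sum of a word. -/
def vsum (w : List ℕ) : ℤ := (w.map mval).sum

/-- A (q-2)-colored Motzkin word over the alphabet Z_q = {0,...,q-1}:
all letters < q, every prefix has nonnegative value-sum, total value-sum 0. -/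
def IsMotzkinWord (q : ℕ) (w : List ℕ) : Prop :=
  (∀ a ∈ w, a < q) ∧ (∀ u, u <+: w → 0 ≤ vsum u) ∧ vsum w = 0

/-- The set 𝓜_{q-2}(n) of (q-2)-colored Motzkin words of length n. -/
def MotzkinSet (q n : ℕ) : Set (List ℕ) := {w | w.length = n ∧ IsMotzkinWord q w}

/-- M_{q-2}(n), the number of (q-2)-colored Motzkin words of length n. -/
noncomputable def Mnum (q n : ℕ) : ℕ := (MotzkinSet q n).ncard

/-- The set Ê_{q-2}(n) of elevated (q-2)-colored Motzkin words of length n: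
words 1α0 with α ∈ 𝓜_{q-2}(n-2). -/
def ElevatedSet (q n : ℕ) : Set (List ℕ) :=
  {w | w.length = n ∧ ∃ α ∈ MotzkinSet q (n - 2), w = 1 :: (α ++ [0])}

/-- The set A_q(n). -/
def SetA (q n : ℕ) : Set (List ℕ) :=
  {w | ∃ i ≤ n / 2, ∃ α ∈ MotzkinSet q i, ∃ β ∈ ElevatedSet q (n - i), w = α ++ β} \
    {w | ∃ α ∈ ElevatedSet q (n / 2), ∃ β ∈ ElevatedSet q (n / 2), w = α ++ β}

/-- The set B_q(n). -/
def SetB (q n : ℕ) : Set (List ℕ) :=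
  {w | ∃ i ≤ n / 2 - 1, ∃ α ∈ MotzkinSet q i, ∃ β ∈ ElevatedSet q (n - i - 1),
    w = 1 :: (α ++ β)}

/-- The set C_q(n): words γ0 with γ a (q-2)-colored Motzkin word of length n-1
having no factor which is an elevated Motzkin word of length j ≥ ⌈n/2⌉. -/
def SetC (q n : ℕ) : Set (List ℕ) :=
  {w | ∃ γ ∈ MotzkinSet q (n - 1),
    (∀ j, (n + 1) / 2 ≤ j → ∀ β ∈ ElevatedSet q j, ¬ β <:+: γ) ∧ w = γ ++ [0]}

/-- The cross-bifix-free candidate set CBFS_q(n). -/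
def CBFS (q n : ℕ) : Set (List ℕ) := SetA q n ∪ SetB q n ∪ SetC q n

/-- A word is bifix-free if no nonempty proper prefix of it is also a suffix of it. -/
def BifixFree (w : List ℕ) : Prop :=
  ∀ u, u <+: w → u ≠ [] → u.length < w.length → ¬ u <:+ w

/-- BF_q(n): the set of bifix-free words of length n over Z_q. -/
def BF (q n : ℕ) : Set (List ℕ) := {w | w.length = n ∧ (∀ a ∈ w, a < q) ∧ BifixFree w}

/-- F_{k,q}(n): the number of words of length n over Z_q avoiding k consecutive 0's. -/
noncomputable def Fcount (k q n : ℕ) : ℕ :=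
  {w : List ℕ | w.length = n ∧ (∀ a ∈ w, a < q) ∧ ¬ List.replicate k 0 <:+: w}.ncard

/-- The set S_{k,q}(n) of Bajic--Stojanovic--Chee--Kiah type words: words s of length n
over Z_q with s₁ = ⋯ = s_k = 0, s_{k+1} ≠ 0, s_n ≠ 0, and such that the subword
s_{k+2} ⋯ s_{n-1} contains no k consecutive 0's. -/
def SetS (q k n : ℕ) : Set (List ℕ) :=
  {s | s.length = n ∧ (∀ a ∈ s, a < q) ∧ s.take k = List.replicate k 0 ∧
    s.getD k 0 ≠ 0 ∧ s.getLast? ≠ some 0 ∧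
    ¬ List.replicate k 0 <:+: (s.drop (k + 1)).take (n - k - 2)}

theorem vsum_append (u v : List ℕ) : vsum (u ++ v) = vsum u + vsum v := by
  simp [vsum]

theorem vsum_cons (a : ℕ) (u : List ℕ) : vsum (a :: u) = mval a + vsum u := by
  simp [vsum]

theorem vsum_of_mem_MotzkinSet {q n : ℕ} {w : List ℕ} (hw : w ∈ MotzkinSet q n) :
    vsum w = 0 :=
  hw.2.2.2

theorem vsum_of_mem_ElevatedSet {q n : ℕ} {w : List ℕ} (hw : w ∈ ElevatedSet q n) :
    vsum w = 0 := by
  obtain ⟨-, α, hα, rfl⟩ := hw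
  rw [vsum_cons, vsum_append, vsum_of_mem_MotzkinSet hα]
  simp [vsum, mval]

theorem vsum_of_mem_SetA {q n : ℕ} {w : List ℕ} (hw : w ∈ SetA q n) : vsum w = 0 := by
  obtain ⟨⟨i, -, α, hα, β, hβ, rfl⟩, -⟩ := hw
  rw [vsum_append, vsum_of_mem_MotzkinSet hα, vsum_of_mem_ElevatedSet hβ, add_zero]

theorem vsum_of_mem_SetB {q n : ℕ} {w : List ℕ} (hw : w ∈ SetB q n) : vsum w = 1 := by
  obtain ⟨i, -, α, hα, β, hβ, rfl⟩ := hw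
  rw [vsum_cons, vsum_append, vsum_of_mem_MotzkinSet hα, vsum_of_mem_ElevatedSet hβ]
  simp [mval]

theorem vsum_of_mem_SetC {q n : ℕ} {w : List ℕ} (hw : w ∈ SetC q n) : vsum w = -1 := by
  obtain ⟨γ, hγ, -, rfl⟩ := hw
  rw [vsum_append, vsum_of_mem_MotzkinSet hγ]
  simp [vsum, mval]

theorem finite_words (q n : ℕ) :
    {w : List ℕ | w.length = n ∧ ∀ a ∈ w, a < q}.Finite := by
  refine ((List.finite_length_eq (Fin q) n).image (List.map Fin.val)).subset ?_
  rintro w ⟨hlen, hw⟩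
  exact ⟨w.pmap Fin.mk hw, by simpa using hlen, by simp [List.map_pmap]⟩

theorem lt_of_mem_ElevatedSet {q n : ℕ} (hq : 2 ≤ q) {w : List ℕ}
    (hw : w ∈ ElevatedSet q n) : ∀ a ∈ w, a < q := by
  obtain ⟨-, α, hα, rfl⟩ := hw
  intro a ha
  simp only [List.mem_cons, List.mem_append, List.not_mem_nil, or_false] at ha
  rcases ha with rfl | ha | rfl
  · omega
  · exact hα.2.1 a ha
  · omega

theorem finite_SetA {q : ℕ} (hq : 2 ≤ q) (n : ℕ) : (SetA q n).Finite := by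
  refine (finite_words q n).subset ?_
  rintro w ⟨⟨i, hi, α, hα, β, hβ, rfl⟩, -⟩
  refine ⟨?_, fun a ha => ?_⟩
  · rw [List.length_append, hα.1, hβ.1]
    omega
  · rcases List.mem_append.1 ha with ha | ha
    · exact hα.2.1 a ha
    · exact lt_of_mem_ElevatedSet hq hβ a ha

theorem finite_SetB {q n : ℕ} (hq : 2 ≤ q) (hn : 1 ≤ n) : (SetB q n).Finite := by
  refine (finite_words q n).subset ?_
  rintro w ⟨i, hi, α, hα, β, hβ, rfl⟩
  refine ⟨?_, fun a ha => ?_⟩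
  · rw [List.length_cons, List.length_append, hα.1, hβ.1]
    omega
  · rcases List.mem_cons.1 ha with rfl | ha
    · omega
    rcases List.mem_append.1 ha with ha | ha
    · exact hα.2.1 a ha
    · exact lt_of_mem_ElevatedSet hq hβ a ha

theorem finite_SetC {q n : ℕ} (hq : 1 ≤ q) (hn : 1 ≤ n) : (SetC q n).Finite := by
  refine (finite_words q n).subset ?_
  rintro w ⟨γ, hγ, -, rfl⟩
  refine ⟨?_, fun a ha => ?_⟩
  · rw [List.length_append, hγ.1, List.length_singleton]
    omega
  · rcases List.mem_append.1 ha with ha | ha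
    · exact hγ.2.1 a ha
    · rw [List.mem_singleton.1 ha]
      omega

/-- A_q(n), B_q(n), C_q(n) are pairwise disjoint, hence
|CBFS_q(n)| = |A_q(n)| + |B_q(n)| + |C_q(n)|. -/
theorem cbfs_card_sum (q n : ℕ) (hq : 3 ≤ q) (hn : 3 ≤ n) :
    Disjoint (SetA q n) (SetB q n) ∧ Disjoint (SetA q n) (SetC q n) ∧
    Disjoint (SetB q n) (SetC q n) ∧
    (CBFS q n).ncard = (SetA q n).ncard + (SetB q n).ncard + (SetC q n).ncard := by
  have hAB : Disjoint (SetA q n) (SetB q n) := Set.disjoint_left.2 fun w hA hB => by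
    have := vsum_of_mem_SetA hA
    have := vsum_of_mem_SetB hB
    omega
  have hAC : Disjoint (SetA q n) (SetC q n) := Set.disjoint_left.2 fun w hA hC => by
    have := vsum_of_mem_SetA hA
    have := vsum_of_mem_SetC hC
    omega
  have hBC : Disjoint (SetB q n) (SetC q n) := Set.disjoint_left.2 fun w hB hC => by
    have := vsum_of_mem_SetB hB
    have := vsum_of_mem_SetC hC
    omega
  have fA : (SetA q n).Finite := finite_SetA (by omega) n
  have fB : (SetB q n).Finite := finite_SetB (by omega) (by omega)
  have fC : (SetC q n).Finite := finite_SetC (by omega) (by omega)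
  refine ⟨hAB, hAC, hBC, ?_⟩
  rw [CBFS, Set.ncard_union_eq (Set.disjoint_union_left.2 ⟨hAC, hBC⟩) (fA.union fB) fC,
    Set.ncard_union_eq hAB fA fB]
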